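/- arXiv:2009.02476 — 4 statements merged into one kernel-verified Lean document; each statement's English description precedes it below -/
import Mathlib

section
/- Let A be a nonempty finite type, f : A → ℝ, a₀ ∈ A, α ∈ (0,1], and c ∈ ℝ. Assume f is injective on A \ {a₀}. Define, for r ∈ ℝ, the updated function f_r by f_r(a₀) = (1-α)·f(a₀) + α·(r + c) and f_r(a) = f(a) for a ≠ a₀. Then for every k ∈ {0, 1, …, |A|-1} there exists r ∈ ℝ such that rank_{f_r}(a₀) := |{a ∈ A : f_r(a) > f_r(a₀)}| = k. -/
theorem Finset.exists_card_filter_lt_eq {R : Type*} [LinearOrder R] [NoMinOrder R] [Nonempty R]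
    (S : Finset R) (k : ℕ) (hk : k ≤ S.card) : ∃ v : R, (S.filter fun x => v < x).card = k := by
  induction S using Finset.induction_on_min generalizing k with
  | empty => exact ⟨Classical.arbitrary R, by simpa [eq_comm] using hk⟩
  | insert m T hm ih =>
    have hmT : m ∉ T := fun h => lt_irrefl m (hm m h)
    rw [Finset.card_insert_of_notMem hmT] at hk
    rcases Nat.le_succ_iff.mp hk with hk | rfl
    · obtain ⟨v, hv⟩ := ih k hk
      refine ⟨max v m, ?_⟩
      rw [Finset.filter_insert, if_neg (not_lt.mpr (le_max_right v m)), ← hv]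
      congr 1
      exact Finset.filter_congr fun x hx => by simp [hm x hx]
    · obtain ⟨v, hv⟩ := exists_lt m
      refine ⟨v, ?_⟩
      rw [Finset.filter_true_of_mem, Finset.card_insert_of_notMem hmT]
      intro x hx
      rcases Finset.mem_insert.mp hx with rfl | hx
      · exact hv
      · exact hv.trans (hm x hx)

open Finset in
/-- If `f` is injective off `a₀`, then by choosing the teacher reward `r`,
the rank (number of strictly larger entries) of the updated entry at `a₀` can be made
any value `k ∈ {0, …, |A|-1}`. -/
theorem rank_reachable (A : Type*) [Fintype A] [Nonempty A] [DecidableEq A]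
    (f : A → ℝ) (a₀ : A) (α c : ℝ) (hα0 : 0 < α) (hα1 : α ≤ 1)
    (hinj : Set.InjOn f {a | a ≠ a₀}) (k : ℕ) (hk : k ≤ Fintype.card A - 1) :
    ∃ r : ℝ,
      ((Finset.univ.filter fun a =>
          Function.update f a₀ ((1 - α) * f a₀ + α * (r + c)) a >
          Function.update f a₀ ((1 - α) * f a₀ + α * (r + c)) a₀).card) = k := by
  have hinj' : Set.InjOn f (univ.erase a₀ : Finset A) := hinj.mono fun a ha => by simpa using ha
  have hcard : ((univ.erase a₀).image f).card = Fintype.card A - 1 := by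
    rw [card_image_of_injOn hinj', card_erase_of_mem (mem_univ a₀), card_univ]
  obtain ⟨v, hv⟩ := exists_card_filter_lt_eq ((univ.erase a₀).image f) k (hcard ▸ hk)
  have hr : (1 - α) * f a₀ + α * ((v - (1 - α) * f a₀) / α - c + c) = v := by
    field_simp
    ring
  refine ⟨(v - (1 - α) * f a₀) / α - c, ?_⟩
  rw [hr, ← hv, filter_image,
    card_image_of_injOn (hinj'.mono (coe_subset.mpr (filter_subset _ _)))]
  congr 1
  ext a
  by_cases ha : a = a₀ <;> simp [ha]
end

section
/- Let A be a finite type, and let f, g : A → ℝ satisfy, for all a, b ∈ A, f(a) ≥ f(b) ↔ g(a) ≥ g(b). Then for every a₀ ∈ A and every v ∈ ℝ there exists w ∈ ℝ such that for all a ≠ a₀: (v > f(a) ↔ w > g(a)) and (v ≥ f(a) ↔ w ≥ g(a)); consequently Function.update f a₀ v and Function.update g a₀ w are again order-equivalent (for all a, b ∈ A, values compare with ≥ in f' iff they do in g'). -/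
/-- A value `v` can be placed relative to the values of `f` on a finite set in the same way as
some value `w` relative to the values of `g`, provided `f` and `g` order that set alike. -/
lemma exists_same_position {A : Type*} {f g : A → ℝ} (s : Finset A)
    (hfg : ∀ a ∈ s, ∀ b ∈ s, f a ≥ f b ↔ g a ≥ g b) (v : ℝ) :
    ∃ w : ℝ, ∀ a ∈ s, (v > f a ↔ w > g a) ∧ (v ≥ f a ↔ w ≥ g a) := by
  by_cases h : ∃ c ∈ s, f c = v
  · obtain ⟨c, hc, rfl⟩ := h
    refine ⟨g c, fun a ha => ⟨?_, hfg c hc a ha⟩⟩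
    simpa only [not_le] using not_congr (hfg a ha c hc)
  · push Not at h
    obtain ⟨w, hlo, hhi⟩ := Order.exists_between_finsets
      ((s.filter (f · < v)).image g) ((s.filter (v < f ·)).image g) (by
        simp only [Finset.forall_mem_image, Finset.mem_filter]
        rintro a ⟨ha, hav⟩ b ⟨hb, hvb⟩
        exact lt_of_not_ge fun hba => (hav.trans hvb).not_ge ((hfg a ha b hb).2 hba))
    simp only [Finset.forall_mem_image, Finset.mem_filter] at hlo hhi
    refine ⟨w, fun a ha => ?_⟩
    rcases (h a ha).lt_or_gt with hav | hva
    · have hw := hlo ⟨ha, hav⟩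
      exact ⟨iff_of_true hav hw, iff_of_true hav.le hw.le⟩
    · have hw := hhi ⟨ha, hva⟩
      exact ⟨iff_of_false hva.not_gt hw.not_gt, iff_of_false hva.not_ge hw.not_ge⟩

/-- The matching-teacher construction: for any single-entry update of `f`
to value `v` at `a₀`, there is a value `w` so that `v`,`w` compare identically (strictly
and non-strictly) to the other entries of `f`,`g`, and hence the updated functions are
again order-equivalent. -/
theorem exists_matching_update (A : Type*) [Fintype A] [DecidableEq A]
    (f g : A → ℝ) (hfg : ∀ a b : A, f a ≥ f b ↔ g a ≥ g b)
    (a₀ : A) (v : ℝ) :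
    ∃ w : ℝ,
      (∀ a ≠ a₀, (v > f a ↔ w > g a) ∧ (v ≥ f a ↔ w ≥ g a)) ∧
      (∀ a b : A,
        Function.update f a₀ v a ≥ Function.update f a₀ v b ↔
        Function.update g a₀ w a ≥ Function.update g a₀ w b) := by
  obtain ⟨w, hw⟩ := exists_same_position (Finset.univ.erase a₀) (fun a _ b _ => hfg a b) v
  replace hw : ∀ a ≠ a₀, (v > f a ↔ w > g a) ∧ (v ≥ f a ↔ w ≥ g a) :=
    fun a ha => hw a (Finset.mem_erase.2 ⟨ha, Finset.mem_univ a⟩)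
  refine ⟨w, hw, fun a b => ?_⟩
  by_cases ha : a = a₀ <;> by_cases hb : b = a₀
  · simp [ha, hb]
  · simpa [ha, hb] using (hw b hb).2
  · simpa [ha, hb] using not_congr (hw a ha).1
  · simpa [ha, hb] using hfg a b
end

section
/- Let S, A be finite types, let α, α' ∈ (0,1] and γ, γ' ∈ [0,1) be the parameters of two Q-learning agents L and L', and let Q, Q' : S → A → ℝ be order-equivalent Q-tables. Fix an experience (s_t, a_t, s_{t+1}) ∈ S × A × S. Then for every reward r ∈ ℝ there exists a reward r' ∈ ℝ such that the updated tables — Q₊ given by Q₊(s_t,a_t) = (1-α)·Q(s_t,a_t) + α·(r + γ·max_{a'} Q(s_{t+1},a')) and Q₊(s,a) = Q(s,a) elsewhere, and Q'₊ defined analogously from Q' with parameters α', γ' and reward r' — are again order-equivalent. -/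
open Finset in
/-- The Q-learning update: upon experience `(st, at, st')` with teacher reward `r`, only the
entry at `(st, at)` changes, to `(1-α)·Q(st,at) + α·(r + γ·max_{a'} Q(st',a'))`. -/
noncomputable def qUpdate {S A : Type*} [Fintype A] [Nonempty A] [DecidableEq S] [DecidableEq A]
    (α γ : ℝ) (Q : S → A → ℝ) (st : S) (at_ : A) (st' : S) (r : ℝ) : S → A → ℝ :=
  Function.update Q st
    (Function.update (Q st) at_
      ((1 - α) * Q st at_ + α * (r + γ * Finset.univ.sup' Finset.univ_nonempty (fun a' => Q st' a'))))

/-- If `f` and `g` order a finite type in the same way, every threshold for `f` has a counterpart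
for `g` in the same relative position. -/
theorem exists_threshold_of_order_equivalent {A : Type*} [Fintype A] (f g : A → ℝ)
    (h : ∀ a a', f a ≥ f a' ↔ g a ≥ g a') (v : ℝ) :
    ∃ w, ∀ a, (f a ≥ v ↔ g a ≥ w) ∧ (v ≥ f a ↔ w ≥ g a) := by
  classical
  by_cases hv : ∃ a, f a = v
  · obtain ⟨a, rfl⟩ := hv
    exact ⟨g a, fun b => ⟨h b a, h a b⟩⟩
  push Not at hv
  obtain ⟨w, hlo, hhi⟩ := Order.exists_between_finsets
    (lo := (Finset.univ.filter fun a => f a < v).image g)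
    (hi := (Finset.univ.filter fun a => v < f a).image g) (by
      simp only [Finset.mem_image, Finset.mem_filter, Finset.mem_univ, true_and]
      rintro _ ⟨a, ha, rfl⟩ _ ⟨b, hb, rfl⟩
      exact lt_of_not_ge fun hab => absurd ((h a b).2 hab) (not_le.2 (ha.trans hb)))
  refine ⟨w, fun a => ?_⟩
  rcases lt_or_gt_of_ne (hv a) with ha | ha
  · have hw : g a < w := hlo _ (Finset.mem_image_of_mem g (by simpa using ha))
    exact ⟨iff_of_false ha.not_ge hw.not_ge, iff_of_true ha.le hw.le⟩
  · have hw : w < g a := hhi _ (Finset.mem_image_of_mem g (by simpa using ha))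
    exact ⟨iff_of_true ha.le hw.le, iff_of_false ha.not_ge hw.not_ge⟩

/-- Single-step matching of two Q-learners: if `Q ≡ Q'` and the first learner
(parameters `α, γ`) is updated with reward `r` on experience `(st, at, st')`, then there is a
reward `r'` for the second learner (parameters `α', γ'`) on the same experience such that the
updated tables are again order-equivalent. -/
theorem qUpdate_matching (S A : Type*) [Fintype S] [Fintype A] [Nonempty A]
    [DecidableEq S] [DecidableEq A]
    (α γ α' γ' : ℝ) (hα : 0 < α ∧ α ≤ 1) (hγ : 0 ≤ γ ∧ γ < 1)
    (hα' : 0 < α' ∧ α' ≤ 1) (hγ' : 0 ≤ γ' ∧ γ' < 1)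
    (Q Q' : S → A → ℝ)
    (h : ∀ (s : S) (a a' : A), Q s a ≥ Q s a' ↔ Q' s a ≥ Q' s a')
    (st : S) (at_ : A) (st' : S) (r : ℝ) :
    ∃ r' : ℝ, ∀ (s : S) (a a' : A),
      qUpdate α γ Q st at_ st' r s a ≥ qUpdate α γ Q st at_ st' r s a' ↔
      qUpdate α' γ' Q' st at_ st' r' s a ≥ qUpdate α' γ' Q' st at_ st' r' s a' := by
  obtain ⟨w, hw⟩ := exists_threshold_of_order_equivalent (Q st) (Q' st) (h st)
    ((1 - α) * Q st at_ + α * (r + γ * Finset.univ.sup' Finset.univ_nonempty (fun a' => Q st' a')))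
  refine ⟨(w - (1 - α') * Q' st at_) / α' -
    γ' * Finset.univ.sup' Finset.univ_nonempty (fun a' => Q' st' a'), fun s a a' => ?_⟩
  unfold qUpdate
  rw [sub_add_cancel, mul_div_cancel₀ _ hα'.1.ne', add_sub_cancel]
  rcases eq_or_ne s st with rfl | hs
  · rw [Function.update_self, Function.update_self]
    by_cases ha : a = at_ <;> by_cases ha' : a' = at_
    · simp [ha, ha']
    · rw [ha, Function.update_self, Function.update_self, Function.update_of_ne ha',
        Function.update_of_ne ha']
      exact (hw a').2
    · rw [ha', Function.update_self, Function.update_self, Function.update_of_ne ha,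
        Function.update_of_ne ha]
      exact (hw a).1
    · simp only [Function.update_of_ne ha, Function.update_of_ne ha']
      exact h s a a'
  · rw [Function.update_of_ne hs, Function.update_of_ne hs]
    exact h s a a'
end

section
/- Let S, A be finite types, let α, α' ∈ (0,1] and γ, γ' ∈ [0,1) be the parameters of two Q-learning agents, and let Q₀, Q'₀ : S → A → ℝ be order-equivalent initial Q-tables. Fix a horizon T ∈ ℕ, a sequence of experiences (s_t, a_t, s'_t) ∈ S × A × S for t < T, and teacher rewards r_t ∈ ℝ for t < T; let Q_{t+1} be obtained from Q_t by the Q-learning update with parameters (α, γ), reward r_t, and experience (s_t, a_t, s'_t). Then there exist rewards r'_t ∈ ℝ, t < T, such that the tables Q'_{t+1} obtained from Q'_t by the Q-learning update with parameters (α', γ'), rewards r'_t, and the same experiences satisfy: Q_t and Q'_t are order-equivalent for every t ≤ T. -/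
/-- If `f` and `g` induce the same preorder, any new value of `f` at a point is matched by some
new value of `g` at that point. -/
theorem exists_update_orderEquiv {A : Type*} [Fintype A] [DecidableEq A] {f g : A → ℝ}
    (h : ∀ a a' : A, f a ≥ f a' ↔ g a ≥ g a') (i : A) (v : ℝ) :
    ∃ w : ℝ, ∀ a a' : A, Function.update f i v a ≥ Function.update f i v a' ↔
      Function.update g i w a ≥ Function.update g i w a' := by
  obtain ⟨w, hw⟩ : ∃ w : ℝ, ∀ a ≠ i, (f a ≥ v ↔ g a ≥ w) ∧ (v ≥ f a ↔ w ≥ g a) := by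
    by_cases hb : ∃ b, f b = v
    · obtain ⟨b, rfl⟩ := hb
      exact ⟨g b, fun a _ => ⟨h a b, h b a⟩⟩
    · push Not at hb
      obtain ⟨w, hlo, hhi⟩ := Order.exists_between_finsets
        ((Finset.univ.filter fun a => f a < v).image g)
        ((Finset.univ.filter fun a => v < f a).image g) (by
          simp only [Finset.mem_image, Finset.mem_filter, Finset.mem_univ, true_and]
          rintro _ ⟨a, ha, rfl⟩ _ ⟨b, hb, rfl⟩
          exact not_le.mp fun hle => absurd ((h a b).mpr hle) (not_le.mpr (ha.trans hb)))
      simp only [Finset.mem_image, Finset.mem_filter, Finset.mem_univ, true_and,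
        forall_exists_index, and_imp, forall_apply_eq_imp_iff₂] at hlo hhi
      refine ⟨w, fun a _ => ?_⟩
      rcases (hb a).lt_or_gt with hlt | hgt
      · have := hlo a hlt
        exact ⟨iff_of_false (not_le.mpr hlt) (not_le.mpr this), iff_of_true hlt.le this.le⟩
      · have := hhi a hgt
        exact ⟨iff_of_true hgt.le this.le, iff_of_false (not_le.mpr hgt) (not_le.mpr this)⟩
  refine ⟨w, fun a a' => ?_⟩
  by_cases ha : a = i <;> by_cases ha' : a' = i
  · simp [ha, ha']
  · subst ha
    simpa [ha'] using (hw a' ha').2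
  · subst ha'
    simpa [ha] using (hw a ha).1
  · simpa [ha, ha'] using h a a'

/-- Any update of one Q-learner is matched, up to order-equivalence, by an update of another
Q-learner with an order-equivalent table. -/
theorem exists_reward_orderEquiv {S A : Type*} [Fintype A] [Nonempty A] [DecidableEq S]
    [DecidableEq A] (α γ : ℝ) {α' : ℝ} (γ' : ℝ) (hα' : α' ≠ 0) {Q Q' : S → A → ℝ}
    (h : ∀ (s : S) (a a' : A), Q s a ≥ Q s a' ↔ Q' s a ≥ Q' s a')
    (s₀ : S) (a₀ : A) (s₁ : S) (r : ℝ) :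
    ∃ r' : ℝ, ∀ (s : S) (a a' : A),
      qUpdate α γ Q s₀ a₀ s₁ r s a ≥ qUpdate α γ Q s₀ a₀ s₁ r s a' ↔
        qUpdate α' γ' Q' s₀ a₀ s₁ r' s a ≥ qUpdate α' γ' Q' s₀ a₀ s₁ r' s a' := by
  obtain ⟨w, hw⟩ := exists_update_orderEquiv (h s₀) a₀
    ((1 - α) * Q s₀ a₀ + α * (r + γ * Finset.univ.sup' Finset.univ_nonempty fun a' => Q s₁ a'))
  refine ⟨(w - (1 - α') * Q' s₀ a₀) / α' -
    γ' * Finset.univ.sup' Finset.univ_nonempty (fun a' => Q' s₁ a'), fun s a a' => ?_⟩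
  by_cases hs : s = s₀
  · subst hs
    simpa only [qUpdate, Function.update_self, sub_add_cancel, mul_div_cancel₀ _ hα',
      add_sub_cancel] using hw a a'
  · simpa only [qUpdate, Function.update_of_ne hs] using h s a a'

/-- Trajectory-wise matching: for any horizon `T`, experience sequence and
teacher rewards driving the first Q-learner, there exist rewards for the second Q-learner
(on the same experiences) keeping the two Q-tables order-equivalent at every `t ≤ T`. -/
theorem trajectory_matching (S A : Type*) [Fintype S] [Fintype A] [Nonempty A]
    [DecidableEq S] [DecidableEq A]
    (α γ α' γ' : ℝ) (hα : 0 < α ∧ α ≤ 1) (hγ : 0 ≤ γ ∧ γ < 1)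
    (hα' : 0 < α' ∧ α' ≤ 1) (hγ' : 0 ≤ γ' ∧ γ' < 1)
    (Q₀ Q₀' : S → A → ℝ)
    (h0 : ∀ (s : S) (a a' : A), Q₀ s a ≥ Q₀ s a' ↔ Q₀' s a ≥ Q₀' s a')
    (T : ℕ) (st : ℕ → S) (at_ : ℕ → A) (st' : ℕ → S) (r : ℕ → ℝ)
    (Q : ℕ → S → A → ℝ) (hQ0 : Q 0 = Q₀)
    (hQ : ∀ t < T, Q (t + 1) = qUpdate α γ (Q t) (st t) (at_ t) (st' t) (r t)) :
    ∃ (r' : ℕ → ℝ) (Q' : ℕ → S → A → ℝ),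
      Q' 0 = Q₀' ∧
      (∀ t < T, Q' (t + 1) = qUpdate α' γ' (Q' t) (st t) (at_ t) (st' t) (r' t)) ∧
      (∀ t ≤ T, ∀ (s : S) (a a' : A), Q t s a ≥ Q t s a' ↔ Q' t s a ≥ Q' t s a') := by
  have step (t : ℕ) (P : S → A → ℝ) : ∃ ρ : ℝ, t < T →
      (∀ (s : S) (a a' : A), Q t s a ≥ Q t s a' ↔ P s a ≥ P s a') →
      ∀ (s : S) (a a' : A), Q (t + 1) s a ≥ Q (t + 1) s a' ↔
        qUpdate α' γ' P (st t) (at_ t) (st' t) ρ s a ≥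
          qUpdate α' γ' P (st t) (at_ t) (st' t) ρ s a' := by
    by_cases h : t < T ∧ ∀ (s : S) (a a' : A), Q t s a ≥ Q t s a' ↔ P s a ≥ P s a'
    · obtain ⟨ρ, hρ⟩ := exists_reward_orderEquiv α γ γ' hα'.1.ne' h.2 (st t) (at_ t) (st' t) (r t)
      exact ⟨ρ, fun _ _ => by rwa [hQ t h.1]⟩
    · exact ⟨0, fun ht hP => absurd ⟨ht, hP⟩ h⟩
  choose ρ hρ using step
  let Q' : ℕ → S → A → ℝ := fun n =>
    Nat.rec Q₀' (fun t P => qUpdate α' γ' P (st t) (at_ t) (st' t) (ρ t P)) n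
  refine ⟨fun t => ρ t (Q' t), Q', rfl, fun _ _ => rfl, fun t => ?_⟩
  induction t with
  | zero => exact fun _ => hQ0 ▸ h0
  | succ t ih => exact fun ht => hρ t (Q' t) ht (ih (Nat.le_of_succ_le ht))
end
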